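/- Let γ = (ξ,η) ∈ 𝒢 and let D, T ∈ ℕ* with 3 ≤ D and 1 ≤ T ≤ C(⌊D/3⌋+1, 2). Then for any integer N ≥ D and any Q ∈ I^{(γ,T)}_N, one can write Q = Σ_{|ν|=N−D} X^ν·P_ν, the sum running over all ν = (ν₀,ν₁,ν₂) ∈ ℕ³ with ν₀+ν₁+ν₂ = N−D and X^ν = X₀^{ν₀}X₁^{ν₁}X₂^{ν₂}, for a choice of polynomials P_ν ∈ I^{(γ,T)}_D satisfying Σ_{|ν|=N−D} 𝓛(P_ν) ≤ c₃(γ)^{2N}·N^{6T·log(N)}·𝓛(Q), where c₃(γ) = (2+|ξ|+|η|⁻¹)·max{1,|ξ|,|η|}. -/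

import Mathlib

open MvPolynomial

/-- The derivation `𝒟 = X₀·∂/∂X₁ + X₂·∂/∂X₂` of `ℂ[X₀,X₁,X₂]`. -/
noncomputable def DD : MvPolynomial (Fin 3) ℂ → MvPolynomial (Fin 3) ℂ :=
  fun P => X 0 * pderiv 1 P + X 2 * pderiv 2 P

/-- The norm of a polynomial: the max of the absolute values of its coefficients. -/
noncomputable def pnorm (P : MvPolynomial (Fin 3) ℂ) : ℝ :=
  ((P.support.sup fun v => ‖P.coeff v‖₊ : NNReal) : ℝ)

/-- The length of a polynomial: the sum of the absolute values of its coefficients. -/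
noncomputable def plen (P : MvPolynomial (Fin 3) ℂ) : ℝ :=
  ∑ v ∈ P.support, ‖P.coeff v‖

/-- The automorphism `τ_γ` of `ℂ[X₀,X₁,X₂]`, `τ_γ(P)(X₀,X₁,X₂) = P(X₀, ξX₀+X₁, ηX₂)`. -/
noncomputable def tauG (ξ η : ℂ) : MvPolynomial (Fin 3) ℂ →ₐ[ℂ] MvPolynomial (Fin 3) ℂ :=
  aeval ![X 0, C ξ * X 0 + X 1, C η * X 2]

/-- The ideal `I^{(γ,T)}` generated by the homogeneous polynomials all of whose
derivatives `𝒟^i P`, `0 ≤ i < T`, vanish at `(1,ξ,η)`. -/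
noncomputable def Igam (ξ η : ℂ) (T : ℕ) : Ideal (MvPolynomial (Fin 3) ℂ) :=
  Ideal.span {P | (∃ d, P.IsHomogeneous d) ∧ ∀ i < T, eval ![1, ξ, η] (DD^[i] P) = 0}

section Length

variable (P Q : MvPolynomial (Fin 3) ℂ)

lemma plen_eq_sum_of_subset {P : MvPolynomial (Fin 3) ℂ} {s : Finset (Fin 3 →₀ ℕ)}
    (h : P.support ⊆ s) : plen P = ∑ v ∈ s, ‖P.coeff v‖ :=
  Finset.sum_subset h fun v _ hv => by simp [notMem_support_iff.mp hv]

lemma plen_nonneg : 0 ≤ plen P := Finset.sum_nonneg fun _ _ => norm_nonneg _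

@[simp] lemma plen_zero : plen 0 = 0 := by simp [plen]

lemma plen_add_le : plen (P + Q) ≤ plen P + plen Q := by
  classical
  rw [plen_eq_sum_of_subset (P := P + Q) support_add,
    plen_eq_sum_of_subset (P := P) Finset.subset_union_left,
    plen_eq_sum_of_subset (P := Q) Finset.subset_union_right, ← Finset.sum_add_distrib]
  exact Finset.sum_le_sum fun v _ => by rw [coeff_add]; exact norm_add_le _ _

lemma plen_monomial (v : Fin 3 →₀ ℕ) (a : ℂ) : plen (monomial v a) = ‖a‖ := by
  classical
  rw [plen_eq_sum_of_subset support_monomial_subset]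
  simp

lemma plen_C_mul (a : ℂ) : plen (C a * P) = ‖a‖ * plen P := by
  have h : (C a * P).support ⊆ P.support := by
    rw [C_mul']
    exact support_smul
  rw [plen_eq_sum_of_subset h, plen, Finset.mul_sum]
  simp

lemma plen_neg : plen (-P) = plen P := by
  simp [plen, support_neg]

lemma plen_sub_le : plen (P - Q) ≤ plen P + plen Q := by
  rw [sub_eq_add_neg, ← plen_neg Q]
  exact plen_add_le _ _

lemma plen_sum_le {ι : Type*} (s : Finset ι) (f : ι → MvPolynomial (Fin 3) ℂ) :
    plen (∑ i ∈ s, f i) ≤ ∑ i ∈ s, plen (f i) := by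
  classical
  induction s using Finset.induction_on with
  | empty => simp
  | insert i s hi ih =>
    rw [Finset.sum_insert hi, Finset.sum_insert hi]
    exact (plen_add_le _ _).trans (by gcongr)

lemma IsHomogeneous.degree_eq_of_mem_support {P : MvPolynomial (Fin 3) ℂ} {n : ℕ}
    (hP : P.IsHomogeneous n) {v : Fin 3 →₀ ℕ} (hv : v ∈ P.support) : v.degree = n := by
  rw [Finsupp.degree_eq_weight_one]
  exact hP (mem_support_iff.mp hv)

/-- A linear map of length at most `K` on monomials of degree `n` expands lengths of forms of
degree `n` at most by the factor `K`. -/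
lemma plen_map_le_of_monomial (φ : MvPolynomial (Fin 3) ℂ →ₗ[ℂ] MvPolynomial (Fin 3) ℂ)
    {n : ℕ} {K : ℝ} (h : ∀ v : Fin 3 →₀ ℕ, v.degree = n → plen (φ (monomial v 1)) ≤ K)
    {P : MvPolynomial (Fin 3) ℂ} (hP : P.IsHomogeneous n) : plen (φ P) ≤ K * plen P := by
  conv_lhs => rw [as_sum P, map_sum]
  refine (plen_sum_le _ _).trans ?_
  rw [plen, Finset.mul_sum]
  refine Finset.sum_le_sum fun v hv => ?_
  have e : monomial v (coeff v P) = coeff v P • monomial v (1 : ℂ) := by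
    rw [smul_monomial, smul_eq_mul, mul_one]
  rw [e, map_smul, ← C_mul', plen_C_mul, mul_comm]
  gcongr
  exact h v (IsHomogeneous.degree_eq_of_mem_support hP hv)

lemma plen_monomial_mul_le (v : Fin 3 →₀ ℕ) : plen (monomial v 1 * P) ≤ plen P := by
  conv_lhs => rw [as_sum P, Finset.mul_sum]
  refine (plen_sum_le _ _).trans (Finset.sum_le_sum fun w _ => ?_)
  rw [monomial_mul, one_mul, plen_monomial]

lemma plen_mul_le : plen (P * Q) ≤ plen P * plen Q := by
  conv_lhs => rw [as_sum P, Finset.sum_mul]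
  refine (plen_sum_le _ _).trans ?_
  rw [plen, Finset.sum_mul]
  refine Finset.sum_le_sum fun v _ => ?_
  have e : monomial v (coeff v P) = C (coeff v P) * monomial v (1 : ℂ) := by
    rw [C_mul', smul_monomial, smul_eq_mul, mul_one]
  rw [e, mul_assoc, plen_C_mul]
  gcongr
  exact plen_monomial_mul_le _ _

lemma plen_pow_le {c : ℝ} (h : plen P ≤ c) (n : ℕ) : plen (P ^ n) ≤ c ^ n := by
  induction n with
  | zero => simpa using (plen_monomial 0 (1 : ℂ)).le
  | succ n ih =>
    rw [pow_succ, pow_succ]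
    exact (plen_mul_le _ _).trans (mul_le_mul ih h (plen_nonneg _) ((plen_nonneg _).trans ih))

lemma prod_X_pow_eq_monomial (v : Fin 3 → ℕ) :
    ∏ j, (X j : MvPolynomial (Fin 3) ℂ) ^ v j = monomial (Finsupp.equivFunOnFinite.symm v) 1 := by
  rw [monomial_eq, Finsupp.prod_fintype _ _ (by simp)]
  simp

lemma norm_eval_le_plen {x : Fin 3 → ℂ} (hx : ∀ i, ‖x i‖ ≤ 1) : ‖eval x P‖ ≤ plen P := by
  rw [eval_eq]
  refine norm_sum_le_of_le _ fun v _ => ?_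
  rw [norm_mul, norm_prod]
  refine mul_le_of_le_one_right (norm_nonneg _) (Finset.prod_le_one (by simp) fun i _ => ?_)
  rw [norm_pow]
  exact pow_le_one₀ (norm_nonneg _) (hx i)

/-- Substituting linear forms of length at most `c` multiplies the length of a form of degree `n`
by at most `c ^ n`. -/
lemma plen_aeval_le {c : ℝ} {f : Fin 3 → MvPolynomial (Fin 3) ℂ} (hf : ∀ i, plen (f i) ≤ c)
    {n : ℕ} {P : MvPolynomial (Fin 3) ℂ} (hP : P.IsHomogeneous n) :
    plen (aeval f P) ≤ c ^ n * plen P := by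
  refine plen_map_le_of_monomial (aeval f).toLinearMap (fun v hv => ?_) hP
  rw [AlgHom.toLinearMap_apply, aeval_monomial, map_one, one_mul,
    Finsupp.prod_fintype _ _ (by simp), Fin.prod_univ_three]
  have hd : v 0 + v 1 + v 2 = n := by
    rw [← hv, Finsupp.degree_eq_sum, Fin.sum_univ_three]
  have h := fun i => plen_pow_le (f i) (hf i) (v i)
  have hc : 0 ≤ c := (plen_nonneg _).trans (hf 0)
  rw [← hd, pow_add, pow_add]
  refine (plen_mul_le _ _).trans ?_
  refine mul_le_mul ((plen_mul_le _ _).trans ?_) (h 2) (plen_nonneg _) (by positivity)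
  exact mul_le_mul (h 0) (h 1) (plen_nonneg _) (by positivity)

end Length

section Jets

/-- `DD` as a derivation. -/
noncomputable def derDD : Derivation ℂ (MvPolynomial (Fin 3) ℂ) (MvPolynomial (Fin 3) ℂ) :=
  (X 0 : MvPolynomial (Fin 3) ℂ) • pderiv 1 + (X 2 : MvPolynomial (Fin 3) ℂ) • pderiv 2

lemma DD_eq_derDD : DD = derDD := rfl

@[simp] lemma derDD_X_zero : derDD (X 0) = 0 := by
  simp [derDD]

@[simp] lemma derDD_X_one : derDD (X 1) = X 0 := by
  simp [derDD]

@[simp] lemma derDD_X_two : derDD (X 2) = X 2 := by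
  simp [derDD]

lemma derDD_C_mul (a : ℂ) (P : MvPolynomial (Fin 3) ℂ) : derDD (C a * P) = C a * derDD P := by
  rw [C_mul', C_mul', Derivation.map_smul]

lemma derDD_X_pow_mul (a b c : ℕ) :
    derDD (X 0 ^ a * X 1 ^ b * X 2 ^ c) =
      C (b : ℂ) * (X 0 ^ (a + 1) * X 1 ^ (b - 1) * X 2 ^ c) +
        C (c : ℂ) * (X 0 ^ a * X 1 ^ b * X 2 ^ c) := by
  have hc : (c : MvPolynomial (Fin 3) ℂ) * (X 2 ^ (c - 1) * X 2 : MvPolynomial (Fin 3) ℂ) =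
      (c : MvPolynomial (Fin 3) ℂ) * X 2 ^ c := by
    cases c with
    | zero => simp
    | succ c => rw [Nat.add_sub_cancel, pow_succ]
  simp only [Derivation.leibniz, Derivation.leibniz_pow, smul_eq_mul, nsmul_eq_mul, derDD_X_zero,
    derDD_X_one, derDD_X_two, map_natCast]
  linear_combination (X 0 ^ a * X 1 ^ b) * hc

/-- The polynomials whose derivatives `DD^[i] P`, `i < T`, vanish at `(1, ξ, η)`. -/
def jetIdeal (ξ η : ℂ) (T : ℕ) : Ideal (MvPolynomial (Fin 3) ℂ) where
  carrier := {P | ∀ i < T, eval ![1, ξ, η] (DD^[i] P) = 0}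
  zero_mem' i _ := by
    rw [DD_eq_derDD, iterate_map_zero, map_zero]
  add_mem' hP hQ i hi := by
    rw [DD_eq_derDD, iterate_map_add, map_add]
    exact (congrArg₂ (· + ·) (hP i hi) (hQ i hi)).trans (add_zero 0)
  smul_mem' A P hP := by
    simp only [Set.mem_ofPred_eq, smul_eq_mul, DD_eq_derDD] at hP ⊢
    induction T generalizing A P with
    | zero => intro i hi; omega
    | succ T ih =>
      intro i hi
      cases i with
      | zero =>
        have := hP 0 hi
        simp only [Function.iterate_zero, id] at this ⊢
        rw [map_mul, this, mul_zero]
      | succ i =>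
        rw [Function.iterate_succ_apply, Derivation.leibniz, iterate_map_add, map_add]
        rw [smul_eq_mul, smul_eq_mul, mul_comm P, ih A (derDD P) (fun j hj => ?_) i (by omega),
          ih (derDD A) P (fun j hj => hP j (by omega)) i (by omega), add_zero]
        rw [← Function.iterate_succ_apply]
        exact hP _ (by omega)

lemma mem_jetIdeal {ξ η : ℂ} {T : ℕ} {P : MvPolynomial (Fin 3) ℂ} :
    P ∈ jetIdeal ξ η T ↔ ∀ i < T, eval ![1, ξ, η] (derDD^[i] P) = 0 := Iff.rfl

lemma Igam_le_jetIdeal (ξ η : ℂ) (T : ℕ) : Igam ξ η T ≤ jetIdeal ξ η T :=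
  Ideal.span_le.mpr fun _ hP => hP.2

lemma mem_Igam_of_mem_jetIdeal {ξ η : ℂ} {T n : ℕ} {P : MvPolynomial (Fin 3) ℂ}
    (hP : P ∈ jetIdeal ξ η T) (hn : P.IsHomogeneous n) : P ∈ Igam ξ η T :=
  Ideal.subset_span ⟨⟨n, hn⟩, hP⟩

/-- The operator `DD - c`. -/
noncomputable def shiftDD (c : ℂ) : MvPolynomial (Fin 3) ℂ →ₗ[ℂ] MvPolynomial (Fin 3) ℂ :=
  derDD.toLinearMap - c • LinearMap.id

lemma shiftDD_apply (c : ℂ) (P : MvPolynomial (Fin 3) ℂ) :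
    shiftDD c P = derDD P - C c * P := by
  simp [shiftDD, C_mul']

/-- The operator `(DD - y (j-1)) ⋯ (DD - y 0)`. -/
noncomputable def iterShift (y : ℕ → ℂ) : ℕ → MvPolynomial (Fin 3) ℂ →ₗ[ℂ] MvPolynomial (Fin 3) ℂ
  | 0 => LinearMap.id
  | j + 1 => shiftDD (y j) ∘ₗ iterShift y j

lemma iterShift_succ_apply (y : ℕ → ℂ) (j : ℕ) (P : MvPolynomial (Fin 3) ℂ) :
    iterShift y (j + 1) P = derDD (iterShift y j P) - C (y j) * iterShift y j P := by
  rw [iterShift, LinearMap.comp_apply, shiftDD_apply]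

lemma iterate_derDD_iterShift_succ (y : ℕ → ℂ) (i j : ℕ) (P : MvPolynomial (Fin 3) ℂ) :
    derDD^[i] (iterShift y (j + 1) P) =
      derDD^[i + 1] (iterShift y j P) - C (y j) * derDD^[i] (iterShift y j P) := by
  rw [iterShift_succ_apply, iterate_map_sub, Function.iterate_succ_apply]
  congr 1
  induction i with
  | zero => rfl
  | succ i ih => rw [Function.iterate_succ_apply', ih, derDD_C_mul, Function.iterate_succ_apply']

lemma mem_jetIdeal_iff_iterShift (y : ℕ → ℂ) {ξ η : ℂ} {T : ℕ} {P : MvPolynomial (Fin 3) ℂ} :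
    P ∈ jetIdeal ξ η T ↔ ∀ j < T, eval ![1, ξ, η] (iterShift y j P) = 0 := by
  rw [mem_jetIdeal]
  constructor
  · intro h
    have key : ∀ j i, i + j < T → eval ![1, ξ, η] (derDD^[i] (iterShift y j P)) = 0 := by
      intro j
      induction j with
      | zero => exact fun i hi => h i hi
      | succ j ih =>
        intro i hi
        rw [iterate_derDD_iterShift_succ, map_sub, map_mul, ih _ (by omega), ih _ (by omega),
          mul_zero, sub_zero]
    exact fun j hj => key j 0 (by omega)
  · intro h
    have key : ∀ i j, i + j < T → eval ![1, ξ, η] (derDD^[i] (iterShift y j P)) = 0 := by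
      intro i
      induction i with
      | zero => exact fun j hj => h j (by omega)
      | succ i ih =>
        intro j hj
        have e := congrArg (eval ![1, ξ, η]) (iterate_derDD_iterShift_succ y i j P)
        rw [map_sub, map_mul, ih _ (by omega), ih _ (by omega), mul_zero, sub_zero] at e
        exact e.symm
    exact fun i hi => key i 0 (by omega)

lemma isHomogeneous_X_pow_mul (a b c : ℕ) :
    (X 0 ^ a * X 1 ^ b * X 2 ^ c : MvPolynomial (Fin 3) ℂ).IsHomogeneous (a + b + c) :=
  ((isHomogeneous_X_pow 0 a).mul (isHomogeneous_X_pow 1 b)).mul (isHomogeneous_X_pow 2 c)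

lemma monomial_eq_X_pow_mul (v : Fin 3 →₀ ℕ) :
    monomial v (1 : ℂ) = X 0 ^ v 0 * X 1 ^ v 1 * X 2 ^ v 2 := by
  rw [monomial_eq, Finsupp.prod_fintype _ _ (by simp), Fin.prod_univ_three, map_one, one_mul]

lemma plen_X_pow_mul_le (a b c : ℕ) :
    plen (X 0 ^ a * X 1 ^ b * X 2 ^ c : MvPolynomial (Fin 3) ℂ) ≤ 1 := by
  have h := prod_X_pow_eq_monomial ![a, b, c]
  rw [Fin.prod_univ_three] at h
  exact le_of_eq (by simpa [plen_monomial] using congrArg plen h)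

lemma degree_fin_three (v : Fin 3 →₀ ℕ) : v.degree = v 0 + v 1 + v 2 := by
  rw [Finsupp.degree_eq_sum, Fin.sum_univ_three]

lemma isHomogeneous_shiftDD (c : ℂ) {n : ℕ} {P : MvPolynomial (Fin 3) ℂ}
    (hP : P.IsHomogeneous n) : (shiftDD c P).IsHomogeneous n := by
  have h1 : ∀ v : Fin 3 →₀ ℕ, v.degree = n → (derDD (monomial v (1 : ℂ))).IsHomogeneous n := by
    intro v hv
    rw [degree_fin_three] at hv
    rw [monomial_eq_X_pow_mul, derDD_X_pow_mul]
    refine IsHomogeneous.add ?_ ?_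
    · rcases Nat.eq_zero_or_pos (v 1) with h | h
      · simpa [h] using isHomogeneous_zero (Fin 3) ℂ n
      · have := (isHomogeneous_X_pow_mul (v 0 + 1) (v 1 - 1) (v 2)).C_mul (v 1 : ℂ)
        rwa [show v 0 + 1 + (v 1 - 1) + v 2 = n by omega] at this
    · exact hv ▸ (isHomogeneous_X_pow_mul (v 0) (v 1) (v 2)).C_mul _
  rw [shiftDD_apply]
  refine IsHomogeneous.sub ?_ (hP.C_mul _)
  rw [as_sum P, map_sum]
  refine IsHomogeneous.sum _ _ _ fun v hv => ?_
  have e : monomial v (coeff v P) = coeff v P • monomial v (1 : ℂ) := by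
    rw [smul_monomial, smul_eq_mul, mul_one]
  rw [e, Derivation.map_smul, ← C_mul']
  exact (h1 v (IsHomogeneous.degree_eq_of_mem_support hP hv)).C_mul _

lemma plen_shiftDD_le {k x n : ℕ} (hx : x ≤ k) {P : MvPolynomial (Fin 3) ℂ}
    (hP : P.IsHomogeneous n) : plen (shiftDD x P) ≤ (n + k) * plen P := by
  refine plen_map_le_of_monomial _ (fun v hv => ?_) hP
  rw [degree_fin_three] at hv
  rw [shiftDD_apply, monomial_eq_X_pow_mul, derDD_X_pow_mul, add_sub_assoc, ← sub_mul, ← C_sub]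
  refine (plen_add_le _ _).trans ?_
  rw [plen_C_mul, plen_C_mul]
  have h1 : ‖((v 2 : ℕ) : ℂ) - x‖ ≤ max (v 2 : ℝ) k := by
    have : ((v 2 : ℕ) : ℂ) - x = (((v 2 : ℝ) - x : ℝ) : ℂ) := by push_cast; rfl
    rw [this, Complex.norm_real, Real.norm_eq_abs, abs_sub_le_iff]
    have : (x : ℝ) ≤ k := by exact_mod_cast hx
    have := le_max_left (v 2 : ℝ) k
    have := le_max_right (v 2 : ℝ) k
    constructor <;> linarith [(v 2).cast_nonneg (α := ℝ), x.cast_nonneg (α := ℝ)]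
  have h2 : ‖((v 1 : ℕ) : ℂ)‖ = v 1 := by simp
  have h3 : (v 1 : ℝ) + v 2 ≤ n := by exact_mod_cast (by omega : v 1 + v 2 ≤ n)
  have h4 : max (v 2 : ℝ) k ≤ v 2 + k :=
    max_le (by linarith [k.cast_nonneg (α := ℝ)]) (by linarith [(v 2).cast_nonneg (α := ℝ)])
  calc _ ≤ (v 1 : ℝ) * 1 + (v 2 + k) * 1 := by
        rw [h2]
        gcongr
        · exact plen_X_pow_mul_le _ _ _
        · exact plen_nonneg _
        · exact h1.trans h4
        · exact plen_X_pow_mul_le _ _ _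
    _ ≤ n + k := by linarith

lemma isHomogeneous_iterShift (y : ℕ → ℂ) (j : ℕ) {n : ℕ} {P : MvPolynomial (Fin 3) ℂ}
    (hP : P.IsHomogeneous n) : (iterShift y j P).IsHomogeneous n := by
  induction j with
  | zero => exact hP
  | succ j ih =>
    rw [iterShift, LinearMap.comp_apply]
    exact isHomogeneous_shiftDD _ ih

lemma plen_iterShift_le {k n : ℕ} {x : ℕ → ℕ} (j : ℕ) (hx : ∀ i < j, x i ≤ k)
    {P : MvPolynomial (Fin 3) ℂ} (hP : P.IsHomogeneous n) :
    plen (iterShift (fun i => (x i : ℂ)) j P) ≤ (n + k) ^ j * plen P := by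
  induction j with
  | zero => simp [iterShift]
  | succ j ih =>
    have h := plen_shiftDD_le (hx j (by omega)) (isHomogeneous_iterShift (fun i => (x i : ℂ)) j hP)
    rw [iterShift, LinearMap.comp_apply]
    refine h.trans ?_
    rw [pow_succ', mul_assoc]
    gcongr
    exact ih fun i hi => hx i (by omega)

end Jets

section Interpolation

/-- The normalized form of degree `k` which dehomogenizes to `z ^ m / m! * exp (c * z)` along the
flow of `DD`. -/
noncomputable def expMono (k m c : ℕ) : MvPolynomial (Fin 3) ℂ :=
  C ((m.factorial : ℂ)⁻¹) * (X 0 ^ (k - m - c) * X 1 ^ m * X 2 ^ c)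

lemma shiftDD_expMono_zero (k c : ℕ) : shiftDD c (expMono k 0 c) = 0 := by
  rw [shiftDD_apply, expMono, derDD_C_mul, derDD_X_pow_mul]
  simp

lemma shiftDD_expMono_succ {k m c : ℕ} (h : m + 1 + c ≤ k) :
    shiftDD c (expMono k (m + 1) c) = expMono k m c := by
  rw [shiftDD_apply, expMono, derDD_C_mul, derDD_X_pow_mul, expMono,
    show k - (m + 1) - c + 1 = k - m - c by omega, Nat.add_sub_cancel]
  have e : (C (((m + 1).factorial : ℂ)⁻¹) * C ((m + 1 : ℕ) : ℂ) : MvPolynomial (Fin 3) ℂ) =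
      C ((m.factorial : ℂ)⁻¹) := by
    rw [← C_mul, Nat.factorial_succ]
    congr 1
    have : ((m + 1 : ℕ) : ℂ) ≠ 0 := Nat.cast_ne_zero.mpr (by omega)
    rw [Nat.cast_mul, mul_inv, mul_right_comm, inv_mul_cancel₀ this, one_mul]
  linear_combination (X 0 ^ (k - m - c) * X 1 ^ m * X 2 ^ c) * e

lemma plen_expMono_le (k m c : ℕ) : plen (expMono k m c) ≤ 1 := by
  rw [expMono, plen_C_mul]
  refine mul_le_one₀ ?_ (plen_nonneg _) (plen_X_pow_mul_le _ _ _)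
  rw [norm_inv, Complex.norm_natCast]
  exact inv_le_one_of_one_le₀ (by exact_mod_cast m.factorial_pos)

lemma isHomogeneous_expMono {k m c : ℕ} (h : m + c ≤ k) : (expMono k m c).IsHomogeneous k := by
  have := (isHomogeneous_X_pow_mul (k - m - c) m c).C_mul ((m.factorial : ℂ)⁻¹)
  rwa [show k - m - c + m + c = k by omega] at this

/-- The divided differences, along the nodes `x i, …, x (i + m)`, of the exponential functions
`c ↦ exp (c * z)`, homogenized in degree `k`. -/
noncomputable def expDivDiff (k : ℕ) (x : ℕ → ℕ) : ℕ → ℕ → MvPolynomial (Fin 3) ℂ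
  | 0, i => expMono k 0 (x i)
  | m + 1, i => if x i = x (i + m + 1) then expMono k (m + 1) (x i) else
      C (((x (i + m + 1) : ℂ) - x i)⁻¹) * (expDivDiff k x m (i + 1) - expDivDiff k x m i)

lemma plen_expDivDiff_le (k : ℕ) (x : ℕ → ℕ) (m : ℕ) :
    ∀ i, plen (expDivDiff k x m i) ≤ 2 ^ m := by
  induction m with
  | zero => exact fun i => by simpa [expDivDiff] using plen_expMono_le k 0 (x i)
  | succ m ih =>
    intro i
    rw [expDivDiff]
    split_ifs with h
    · exact (plen_expMono_le _ _ _).trans (one_le_pow₀ one_le_two)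
    · rw [plen_C_mul, norm_inv]
      have h1 : 1 ≤ ‖((x (i + m + 1) : ℕ) : ℂ) - x i‖ := by
        have h2 : ((x (i + m + 1) : ℕ) : ℂ) - x i = (((x (i + m + 1) : ℤ) - x i : ℤ) : ℂ) := by
          push_cast; rfl
        rw [h2, Complex.norm_intCast]
        have h3 : ((x (i + m + 1) : ℤ) - x i) ≠ 0 := sub_ne_zero.mpr (by exact_mod_cast Ne.symm h)
        exact_mod_cast Int.one_le_abs h3
      calc _ ≤ (1 : ℝ) * (2 ^ m + 2 ^ m) := by
            refine mul_le_mul ?_ ?_ (plen_nonneg _) zero_le_one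
            · exact inv_le_one_of_one_le₀ h1
            · exact (plen_sub_le _ _).trans (add_le_add (ih _) (ih _))
        _ = 2 ^ (m + 1) := by ring

lemma eval_expDivDiff_zero (k : ℕ) (x : ℕ → ℕ) (i : ℕ) :
    eval ![1, 0, 1] (expDivDiff k x 0 i) = 1 := by
  simp [expDivDiff, expMono]

lemma eval_expDivDiff_succ (k : ℕ) (x : ℕ → ℕ) (m : ℕ) :
    ∀ i, eval ![1, 0, 1] (expDivDiff k x (m + 1) i) = 0 := by
  induction m with
  | zero =>
    intro i
    rw [expDivDiff]
    split_ifs with h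
    · simp [expMono]
    · rw [map_mul, map_sub, eval_expDivDiff_zero, eval_expDivDiff_zero, sub_self, mul_zero]
  | succ m ih =>
    intro i
    rw [expDivDiff]
    split_ifs with h
    · simp [expMono]
    · rw [map_mul, map_sub, ih, ih, sub_self, mul_zero]

/-- The nodes `x i`, `i < S`, form a nondecreasing sequence in which a node `c` has multiplicity at
most `k + 1 - c`. -/
structure IsAdmissible (k S : ℕ) (x : ℕ → ℕ) : Prop where
  mono : Monotone x
  le : ∀ i m, i + m < S → x i = x (i + m) → m + x i ≤ k

variable {k S : ℕ} {x : ℕ → ℕ}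

lemma IsAdmissible.node_le (hx : IsAdmissible k S x) {i : ℕ} (hi : i < S) : x i ≤ k := by
  simpa using hx.le i 0 hi rfl

lemma isHomogeneous_expDivDiff (hx : IsAdmissible k S x) (m : ℕ) :
    ∀ i, i + m < S → (expDivDiff k x m i).IsHomogeneous k := by
  induction m with
  | zero => exact fun i hi => isHomogeneous_expMono (hx.le i 0 hi rfl)
  | succ m ih =>
    intro i hi
    rw [expDivDiff]
    split_ifs with h
    · exact isHomogeneous_expMono (hx.le i (m + 1) hi h)
    · exact ((ih _ (by omega)).sub (ih _ (by omega))).C_mul _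

lemma expDivDiff_of_eq {m i : ℕ} (h : x i = x (i + m)) :
    expDivDiff k x m i = expMono k m (x i) := by
  cases m with
  | zero => rfl
  | succ m => rw [expDivDiff, if_pos (by exact h)]

lemma shiftDD_expDivDiff_zero (i : ℕ) : shiftDD (x i) (expDivDiff k x 0 i) = 0 :=
  shiftDD_expMono_zero _ _

lemma shiftDD_eq_add (a b : ℂ) (P : MvPolynomial (Fin 3) ℂ) :
    shiftDD a P = shiftDD b P + C (b - a) * P := by
  rw [shiftDD_apply, shiftDD_apply, C_sub]
  ring

lemma shiftDD_C_mul (a b : ℂ) (P : MvPolynomial (Fin 3) ℂ) :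
    shiftDD a (C b * P) = C b * shiftDD a P := by
  rw [C_mul', map_smul, C_mul']

lemma shiftDD_expDivDiff_succ (hx : IsAdmissible k S x) (m : ℕ) :
    ∀ i, i + m + 1 < S → shiftDD (x i) (expDivDiff k x (m + 1) i) = expDivDiff k x m (i + 1) ∧
      shiftDD (x (i + m + 1)) (expDivDiff k x (m + 1) i) = expDivDiff k x m i := by
  have key : ∀ m i, i + m + 1 < S → (x i ≠ x (i + m + 1) →
      shiftDD (x i) (expDivDiff k x m i) = shiftDD (x (i + m + 1)) (expDivDiff k x m (i + 1))) →
      shiftDD (x i) (expDivDiff k x (m + 1) i) = expDivDiff k x m (i + 1) ∧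
        shiftDD (x (i + m + 1)) (expDivDiff k x (m + 1) i) = expDivDiff k x m i := by
    intro m i hi hd
    by_cases h : x i = x (i + m + 1)
    · have h1 : x (i + 1) = x i :=
        le_antisymm (h ▸ hx.mono (by omega)) (hx.mono (by omega))
      have h2 : x i = x (i + m) :=
        le_antisymm (hx.mono (by omega)) (h ▸ hx.mono (by omega))
      have h3 : x (i + 1) = x (i + 1 + m) := by
        rw [h1, h]; congr 1; omega
      rw [← h, expDivDiff_of_eq (m := m + 1) (i := i) (by exact h), expDivDiff_of_eq h2,
        expDivDiff_of_eq h3, h1, shiftDD_expMono_succ (hx.le i (m + 1) hi h)]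
      exact ⟨rfl, rfl⟩
    · have hne : ((x (i + m + 1) : ℂ) - x i) ≠ 0 :=
        sub_ne_zero.mpr (by exact_mod_cast Ne.symm h)
      have hC : (C (((x (i + m + 1) : ℂ) - x i)⁻¹) * C ((x (i + m + 1) : ℂ) - x i) :
          MvPolynomial (Fin 3) ℂ) = 1 := by
        rw [← C_mul, inv_mul_cancel₀ hne, C_1]
      have e1 := shiftDD_eq_add (x i) (x (i + m + 1)) (expDivDiff k x m (i + 1))
      have e2 := shiftDD_eq_add (x i) (x (i + m + 1)) (expDivDiff k x m i)
      have e3 := hd h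
      rw [expDivDiff, if_neg h, shiftDD_C_mul, shiftDD_C_mul, map_sub, map_sub]
      constructor
      · rw [e1, e3]
        linear_combination (expDivDiff k x m (i + 1)) * hC
      · rw [← e3, e2]
        linear_combination (expDivDiff k x m i) * hC
  induction m with
  | zero =>
    refine fun i hi => key 0 i hi fun _ => ?_
    rw [shiftDD_expDivDiff_zero]
    exact (shiftDD_expDivDiff_zero (i + 1)).symm
  | succ m ih =>
    refine fun i hi => key (m + 1) i hi fun _ => ?_
    rw [(ih i (by omega)).1, show i + (m + 1) + 1 = i + 1 + m + 1 by omega,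
      (ih (i + 1) (by omega)).2]

lemma iterShift_expDivDiff_of_le (hx : IsAdmissible k S x) {m : ℕ} (hm : m < S) :
    ∀ j d, j + d = m →
      iterShift (fun i => (x i : ℂ)) j (expDivDiff k x m 0) = expDivDiff k x d j := by
  intro j
  induction j with
  | zero => intro d hd; rw [← hd, zero_add]; rfl
  | succ j ih =>
    intro d hd
    rw [iterShift, LinearMap.comp_apply, ih (d + 1) (by omega)]
    exact (shiftDD_expDivDiff_succ hx d j (by omega)).1

lemma iterShift_expDivDiff_of_lt (hx : IsAdmissible k S x) {m : ℕ} (hm : m < S) (j : ℕ) :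
    iterShift (fun i => (x i : ℂ)) (m + 1 + j) (expDivDiff k x m 0) = 0 := by
  induction j with
  | zero =>
    rw [add_zero, iterShift, LinearMap.comp_apply, iterShift_expDivDiff_of_le hx hm m 0 rfl]
    exact shiftDD_expDivDiff_zero m
  | succ j ih => rw [← add_assoc, iterShift, LinearMap.comp_apply, ih, map_zero]

lemma eval_iterShift_expDivDiff (hx : IsAdmissible k S x) {m : ℕ} (hm : m < S) (j : ℕ) :
    eval ![1, 0, 1] (iterShift (fun i => (x i : ℂ)) j (expDivDiff k x m 0)) =
      if j = m then 1 else 0 := by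
  rcases lt_trichotomy j m with h | h | h
  · rw [iterShift_expDivDiff_of_le hx hm j (m - j - 1 + 1) (by omega), eval_expDivDiff_succ,
      if_neg h.ne]
  · rw [iterShift_expDivDiff_of_le hx hm j 0 (by omega), eval_expDivDiff_zero, if_pos h]
  · have := iterShift_expDivDiff_of_lt hx hm (j - m - 1)
    rw [show m + 1 + (j - m - 1) = j by omega] at this
    rw [this, map_zero, if_neg h.ne']

/-- The form of degree `k` which interpolates the `T`-jet at `(1, 0, 1)` of a given polynomial. -/
noncomputable def interp (k : ℕ) (x : ℕ → ℕ) (T : ℕ) :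
    MvPolynomial (Fin 3) ℂ →ₗ[ℂ] MvPolynomial (Fin 3) ℂ :=
  ∑ j ∈ Finset.range T, ((aeval (R := ℂ) ![(1 : ℂ), 0, 1]).toLinearMap ∘ₗ
    iterShift (fun i => (x i : ℂ)) j).smulRight (expDivDiff k x j 0)

lemma interp_apply (T : ℕ) (P : MvPolynomial (Fin 3) ℂ) :
    interp k x T P = ∑ j ∈ Finset.range T,
      C (eval ![1, 0, 1] (iterShift (fun i => (x i : ℂ)) j P)) * expDivDiff k x j 0 := by
  simp [interp, LinearMap.sum_apply, C_mul']

lemma isHomogeneous_interp (hx : IsAdmissible k S x) {T : ℕ} (hT : T ≤ S)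
    (P : MvPolynomial (Fin 3) ℂ) : (interp k x T P).IsHomogeneous k := by
  rw [interp_apply]
  refine IsHomogeneous.sum _ _ _ fun j hj => ?_
  rw [Finset.mem_range] at hj
  exact (isHomogeneous_expDivDiff hx j 0 (by omega)).C_mul _

lemma interp_eq_zero {T : ℕ} {P : MvPolynomial (Fin 3) ℂ} (hP : P ∈ jetIdeal 0 1 T) :
    interp k x T P = 0 := by
  rw [interp_apply]
  refine Finset.sum_eq_zero fun j hj => ?_
  rw [(mem_jetIdeal_iff_iterShift _).mp hP j (Finset.mem_range.mp hj), C_0, zero_mul]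

lemma iterShift_X_zero_pow_mul (y : ℕ → ℂ) (a j : ℕ) (P : MvPolynomial (Fin 3) ℂ) :
    iterShift y j (X 0 ^ a * P) = X 0 ^ a * iterShift y j P := by
  induction j with
  | zero => rfl
  | succ j ih =>
    rw [iterShift_succ_apply, iterShift_succ_apply, ih, Derivation.leibniz,
      Derivation.leibniz_pow, derDD_X_zero]
    simp only [smul_eq_mul, mul_zero, smul_zero, add_zero]
    ring

lemma sub_interp_mem_jetIdeal (hx : IsAdmissible k S x) {T : ℕ} (hT : T ≤ S) (a : ℕ)
    (P : MvPolynomial (Fin 3) ℂ) : P - X 0 ^ a * interp k x T P ∈ jetIdeal 0 1 T := by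
  rw [mem_jetIdeal_iff_iterShift fun i => (x i : ℂ)]
  intro j hj
  rw [map_sub, iterShift_X_zero_pow_mul, interp_apply, map_sum, map_sub, map_mul, map_sum,
    Finset.sum_eq_single j]
  · rw [C_mul', map_smul, ← C_mul', map_mul, eval_iterShift_expDivDiff hx (by omega)]
    simp
  · intro i hi hij
    rw [Finset.mem_range] at hi
    rw [C_mul', map_smul, ← C_mul', map_mul, eval_iterShift_expDivDiff hx (by omega),
      if_neg hij.symm, mul_zero]
  · exact fun h => absurd (Finset.mem_range.mpr hj) h

lemma plen_interp_le (hx : IsAdmissible k S x) {T : ℕ} (hT : T ≤ S) {n : ℕ} (hn : 1 ≤ n)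
    {P : MvPolynomial (Fin 3) ℂ} (hP : P.IsHomogeneous n) :
    plen (interp k x T P) ≤ ((2 * (n + k)) ^ T - 1) * plen P := by
  have hq : (2 : ℝ) ≤ 2 * (n + k) := by
    have h1 : (1 : ℝ) ≤ n := by exact_mod_cast hn
    linarith [k.cast_nonneg (α := ℝ)]
  have hgeom : ∑ j ∈ Finset.range T, (2 * (n + k) : ℝ) ^ j ≤ (2 * (n + k)) ^ T - 1 := by
    have h1 := mul_geom_sum (2 * (n + k) : ℝ) T
    have h2 : (0 : ℝ) ≤ ∑ j ∈ Finset.range T, (2 * (n + k) : ℝ) ^ j := by positivity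
    nlinarith
  refine le_trans ?_ (mul_le_mul_of_nonneg_right hgeom (plen_nonneg P))
  rw [interp_apply, Finset.sum_mul]
  refine (plen_sum_le _ _).trans (Finset.sum_le_sum fun j hj => ?_)
  rw [Finset.mem_range] at hj
  rw [plen_C_mul]
  have h1 : ‖eval ![1, 0, 1] (iterShift (fun i => (x i : ℂ)) j P)‖ ≤ (n + k) ^ j * plen P := by
    refine (norm_eval_le_plen _ fun i => ?_).trans
      (plen_iterShift_le j (fun i hi => hx.node_le (by omega)) hP)
    fin_cases i <;> simp
  calc _ ≤ ((n + k) ^ j * plen P) * 2 ^ j := by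
        exact mul_le_mul h1 (plen_expDivDiff_le _ _ _ _) (plen_nonneg _)
          (mul_nonneg (by positivity) (plen_nonneg _))
    _ = _ := by rw [mul_pow]; ring

/-- The nondecreasing sequence of nodes in which `c ≤ k` occurs `k + 1 - c` times. -/
def node : ℕ → ℕ → ℕ
  | 0, _ => 0
  | k + 1, i => if i ≤ k + 1 then 0 else 1 + node k (i - (k + 2))

lemma isAdmissible_node (k : ℕ) : IsAdmissible k ((k + 2).choose 2) (node k) := by
  induction k with
  | zero =>
    refine ⟨fun _ _ _ => le_rfl, fun i m h _ => ?_⟩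
    simp only [zero_add, Nat.choose_self, node] at h ⊢
    omega
  | succ k ih =>
    refine ⟨fun i j hij => ?_, fun i m h hi => ?_⟩
    · simp only [node]
      have := ih.mono (show i - (k + 2) ≤ j - (k + 2) by omega)
      split_ifs <;> omega
    · have hc : (k + 1 + 2).choose 2 = k + 2 + (k + 2).choose 2 := by
        rw [Nat.choose_succ_succ' (k + 2) 1, Nat.choose_one_right]
      simp only [node] at hi ⊢
      split_ifs at hi ⊢ with h1 h2 h2 <;> try omega
      have := ih.le (i - (k + 2)) m (by omega) (by
        rw [show i - (k + 2) + m = i + m - (k + 2) by omega]; omega)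
      omega

end Interpolation

section Decomposition

/-- `IsFormSum ξ η T D n K p` says that `p` is a sum of products of a monomial of degree `n - D` and
a form of degree `D` in `jetIdeal ξ η T`, these forms having total length at most `K`. -/
inductive IsFormSum (ξ η : ℂ) (T D : ℕ) : ℕ → ℝ → MvPolynomial (Fin 3) ℂ → Prop
  | prod_mul (ν : Fin 3 → ℕ) {P : MvPolynomial (Fin 3) ℂ} (hP : P ∈ jetIdeal ξ η T)
      (hD : P.IsHomogeneous D) : IsFormSum ξ η T D (∑ j, ν j + D) (plen P) ((∏ j, X j ^ ν j) * P)
  | zero (n : ℕ) : IsFormSum ξ η T D n 0 0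
  | add {n : ℕ} {K L : ℝ} {p q : MvPolynomial (Fin 3) ℂ} (hp : IsFormSum ξ η T D n K p)
      (hq : IsFormSum ξ η T D n L q) : IsFormSum ξ η T D n (K + L) (p + q)
  | mono {n : ℕ} {K L : ℝ} {p : MvPolynomial (Fin 3) ℂ} (hp : IsFormSum ξ η T D n K p)
      (h : K ≤ L) : IsFormSum ξ η T D n L p

namespace IsFormSum

variable {ξ η : ℂ} {T D n : ℕ} {K : ℝ} {p : MvPolynomial (Fin 3) ℂ}

lemma of_mem (hp : p ∈ jetIdeal ξ η T) (hD : p.IsHomogeneous D) :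
    IsFormSum ξ η T D D (plen p) p := by
  simpa using prod_mul (fun _ => 0) hp hD

lemma prod_X_pow_mul (μ : Fin 3 → ℕ) (hp : IsFormSum ξ η T D n K p) :
    IsFormSum ξ η T D (∑ j, μ j + n) K ((∏ j, X j ^ μ j) * p) := by
  induction hp with
  | prod_mul ν hP hD =>
    have := prod_mul (fun j => μ j + ν j) hP hD
    rw [← mul_assoc, ← Finset.prod_mul_distrib, ← add_assoc, ← Finset.sum_add_distrib]
    simpa only [pow_add] using this
  | zero => simpa using zero _
  | add _ _ ihp ihq => rw [mul_add]; exact ihp.add ihq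
  | mono _ h ih => exact ih.mono h

lemma C_mul (a : ℂ) (hp : IsFormSum ξ η T D n K p) :
    IsFormSum ξ η T D n (‖a‖ * K) (C a * p) := by
  induction hp with
  | prod_mul ν hP hD =>
    rw [mul_left_comm, ← plen_C_mul]
    exact prod_mul ν (Ideal.mul_mem_left _ _ hP) (hD.C_mul a)
  | zero => simpa using zero _
  | add _ _ ihp ihq => rw [mul_add, mul_add]; exact ihp.add ihq
  | mono _ h ih => exact ih.mono (by gcongr)

lemma sum {ι : Type*} (s : Finset ι) (L : ι → ℝ) (q : ι → MvPolynomial (Fin 3) ℂ)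
    (h : ∀ i ∈ s, IsFormSum ξ η T D n (L i) (q i)) :
    IsFormSum ξ η T D n (∑ i ∈ s, L i) (∑ i ∈ s, q i) := by
  classical
  induction s using Finset.induction_on with
  | empty => simpa using zero n
  | insert i s hi ih =>
    rw [Finset.sum_insert hi, Finset.sum_insert hi]
    exact (h i (Finset.mem_insert_self _ _)).add
      (ih fun j hj => h j (Finset.mem_insert_of_mem hj))

lemma map_of_monomial (φ : MvPolynomial (Fin 3) ℂ →ₗ[ℂ] MvPolynomial (Fin 3) ℂ) {d : ℕ}
    (h : ∀ v : Fin 3 →₀ ℕ, v.degree = d → IsFormSum ξ η T D n K (φ (monomial v 1)))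
    {P : MvPolynomial (Fin 3) ℂ} (hP : P.IsHomogeneous d) :
    IsFormSum ξ η T D n (K * plen P) (φ P) := by
  rw [as_sum (φ P), ← as_sum (φ P), as_sum P, map_sum, ← as_sum P, plen, Finset.mul_sum]
  refine sum _ _ _ fun v hv => ?_
  have e : monomial v (coeff v P) = coeff v P • monomial v (1 : ℂ) := by
    rw [smul_monomial, smul_eq_mul, mul_one]
  rw [e, map_smul, ← C_mul', mul_comm K]
  exact (h v (IsHomogeneous.degree_eq_of_mem_support hP hv)).C_mul _

lemma mul {H : MvPolynomial (Fin 3) ℂ} {d : ℕ} (hH : H.IsHomogeneous d)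
    (hp : IsFormSum ξ η T D n K p) : IsFormSum ξ η T D (d + n) (K * plen H) (H * p) := by
  refine map_of_monomial (LinearMap.mulRight ℂ p) (fun v hv => ?_) hH
  have := prod_X_pow_mul v hp
  rwa [prod_X_pow_eq_monomial, ← Finsupp.degree_eq_sum, hv, Finsupp.equivFunOnFinite_symm_coe]
    at this

/-- The transport of a decomposition by a linear substitution preserving the jet conditions. -/
lemma aeval {ξ' η' : ℂ} {c : ℝ} {f : Fin 3 → MvPolynomial (Fin 3) ℂ} (hc : ∀ i, plen (f i) ≤ c)
    (hf : ∀ i, (f i).IsHomogeneous 1)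
    (hJ : ∀ P ∈ jetIdeal ξ η T, MvPolynomial.aeval f P ∈ jetIdeal ξ' η' T)
    (hp : IsFormSum ξ η T D n K p) :
    IsFormSum ξ' η' T D n (c ^ n * K) (MvPolynomial.aeval f p) := by
  have hc0 : 0 ≤ c := (plen_nonneg _).trans (hc 0)
  induction hp with
  | @prod_mul ν P hP hD =>
    have hν : (∏ j, (X j : MvPolynomial (Fin 3) ℂ) ^ ν j).IsHomogeneous (∑ j, ν j) :=
      IsHomogeneous.prod _ _ _ fun j _ => isHomogeneous_X_pow j (ν j)
    have h := (of_mem (hJ P hP) (by simpa using hD.aeval f hf)).mul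
      (H := MvPolynomial.aeval f (∏ j, X j ^ ν j)) (d := ∑ j, ν j) (by rw [← one_mul (∑ j, ν j)]; exact hν.aeval f hf)
    rw [map_mul]
    refine h.mono ?_
    have h1 := plen_aeval_le hc hν
    have h2 : plen (∏ j, (X j : MvPolynomial (Fin 3) ℂ) ^ ν j) = 1 := by
      rw [prod_X_pow_eq_monomial, plen_monomial, norm_one]
    rw [h2, mul_one] at h1
    calc _ ≤ (c ^ D * plen P) * c ^ (∑ j, ν j) :=
          mul_le_mul (plen_aeval_le hc hD) h1 (plen_nonneg _)
            (mul_nonneg (by positivity) (plen_nonneg _))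
      _ = _ := by rw [pow_add]; ring
  | zero => simpa using zero _
  | add _ _ ihp ihq => rw [map_add, mul_add]; exact ihp.add ihq
  | mono _ h ih => exact ih.mono (by gcongr)

lemma exists_eq_sum (hp : IsFormSum ξ η T D n K p) :
    ∃ P : (Fin 3 → ℕ) → MvPolynomial (Fin 3) ℂ,
      (∀ ν ∈ Finset.Nat.antidiagonalTuple 3 (n - D),
        P ν ∈ jetIdeal ξ η T ∧ (P ν).IsHomogeneous D) ∧
      p = ∑ ν ∈ Finset.Nat.antidiagonalTuple 3 (n - D), (∏ j, X j ^ ν j) * P ν ∧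
      ∑ ν ∈ Finset.Nat.antidiagonalTuple 3 (n - D), plen (P ν) ≤ K := by
  classical
  induction hp with
  | @prod_mul ν P hP hD =>
    have hν : ν ∈ Finset.Nat.antidiagonalTuple 3 (∑ j, ν j + D - D) := by
      rw [Finset.Nat.mem_antidiagonalTuple, Nat.add_sub_cancel]
    refine ⟨fun μ => if μ = ν then P else 0, fun μ _ => ?_, ?_, ?_⟩
    · dsimp only
      split_ifs
      · exact ⟨hP, hD⟩
      · exact ⟨zero_mem _, isHomogeneous_zero _ _ _⟩
    · rw [Finset.sum_eq_single_of_mem ν hν fun μ _ h => by simp [h]]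
      simp
    · rw [Finset.sum_eq_single_of_mem ν hν fun μ _ h => by simp [h]]
      simp
  | zero => exact ⟨0, fun _ _ => ⟨zero_mem _, isHomogeneous_zero _ _ _⟩, by simp, by simp⟩
  | add _ _ ihp ihq =>
    obtain ⟨P, hP, rfl, hPK⟩ := ihp
    obtain ⟨Q, hQ, rfl, hQK⟩ := ihq
    refine ⟨P + Q, fun ν hν => ⟨add_mem (hP ν hν).1 (hQ ν hν).1, (hP ν hν).2.add (hQ ν hν).2⟩,
      ?_, ?_⟩
    · simp [mul_add, Finset.sum_add_distrib]
    · refine (Finset.sum_le_sum fun ν _ => plen_add_le (P ν) (Q ν)).trans ?_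
      rw [Finset.sum_add_distrib]
      exact add_le_add hPK hQK
  | mono _ h ih =>
    obtain ⟨P, hP, hp, hK⟩ := ih
    exact ⟨P, hP, hp, hK.trans h⟩

end IsFormSum

lemma interp_X_zero_pow_mul (k : ℕ) (x : ℕ → ℕ) (T a : ℕ) (P : MvPolynomial (Fin 3) ℂ) :
    interp k x T (X 0 ^ a * P) = interp k x T P := by
  rw [interp_apply, interp_apply]
  refine Finset.sum_congr rfl fun j _ => ?_
  rw [iterShift_X_zero_pow_mul, map_mul]
  simp

lemma exists_add_eq_degree_eq {v : Fin 3 →₀ ℕ} {m : ℕ} (hm : m ≤ v.degree) :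
    ∃ u w, u + w = v ∧ w.degree = m := by
  rw [degree_fin_three] at hm
  refine ⟨v - Finsupp.equivFunOnFinite.symm
      ![min (v 0) m, min (v 1) (m - v 0), m - v 0 - v 1],
    Finsupp.equivFunOnFinite.symm ![min (v 0) m, min (v 1) (m - v 0), m - v 0 - v 1],
    tsub_add_cancel_of_le fun i => ?_, ?_⟩
  · fin_cases i <;> simp
    omega
  · rw [degree_fin_three]
    simp
    omega

/-- The exponent in the length bound of `isFormSum_sub_interp`. -/
noncomputable def lengthExponent (D n : ℕ) : ℝ := if n ≤ D then 1 else 3 * Real.log n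

lemma one_le_log {n : ℕ} (hn : 3 ≤ n) : 1 ≤ Real.log n := by
  rw [Real.le_log_iff_exp_le (by positivity)]
  have : (3 : ℝ) ≤ n := by exact_mod_cast hn
  linarith [Real.exp_one_lt_d9]

lemma lengthExponent_le {D n : ℕ} (hn : 3 ≤ n) : lengthExponent D n ≤ 3 * Real.log n := by
  rw [lengthExponent]
  split_ifs
  · linarith [one_le_log hn]
  · rfl

lemma one_add_lengthExponent_le {D m n : ℕ} (hD : 3 ≤ D) (hn : D < n)
    (h : m = D ∨ 3 * m ≤ 2 * n) : 1 + lengthExponent D m ≤ lengthExponent D n := by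
  have hn1 := one_le_log (n := n) (by omega)
  rw [lengthExponent, lengthExponent, if_neg (by omega : ¬ n ≤ D)]
  split_ifs with h1
  · linarith
  · have h2 : 3 * (m : ℝ) ≤ 2 * n := by exact_mod_cast h.resolve_left (by omega)
    have hm0 : (0 : ℝ) < m := by exact_mod_cast (by omega : 0 < m)
    have h3 : Real.log (m * Real.exp (1 / 3)) ≤ Real.log n := by
      refine Real.log_le_log (by positivity) ?_
      have h4 : Real.exp (1 / 3) ≤ 3 / 2 := by
        have h5 : Real.exp (1 / 3) ^ 3 = Real.exp 1 := by
          rw [← Real.exp_nat_mul]; norm_num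
        by_contra! h6
        have := pow_lt_pow_left₀ h6 (by norm_num) (n := 3) (by norm_num)
        rw [h5] at this
        linarith [Real.exp_one_lt_d9]
      nlinarith
    rw [Real.log_mul hm0.ne' (Real.exp_ne_zero _), Real.log_exp] at h3
    linarith

/-- A form of degree `n`, minus its interpolation form padded with a power of `X 0`, decomposes
with lengths controlled by the length bound `B` for interpolation. -/
lemma isFormSum_sub_interp {k S T D N : ℕ} {x : ℕ → ℕ} (hx : IsAdmissible k S x) (hT : T ≤ S)
    (hk : 3 * (k + 1) ≤ D) {B : ℝ} (hB0 : 0 ≤ B)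
    (hB : ∀ n ≤ N, D ≤ n → ∀ P : MvPolynomial (Fin 3) ℂ, P.IsHomogeneous n →
      plen (interp k x T P) ≤ B * plen P) (n : ℕ) (hDn : D ≤ n) (hnN : n ≤ N)
    {P : MvPolynomial (Fin 3) ℂ} (hP : P.IsHomogeneous n) :
    IsFormSum 0 1 T D n ((1 + B) ^ lengthExponent D n * plen P)
      (P - X 0 ^ (n - k) * interp k x T P) := by
  induction n using Nat.strong_induction_on generalizing P with
  | _ n ih =>
  refine IsFormSum.map_of_monomial
    (LinearMap.id - LinearMap.mulLeft ℂ (X 0 ^ (n - k)) ∘ₗ interp k x T) (fun v hv => ?_) hP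
  simp only [LinearMap.sub_apply, LinearMap.id_apply, LinearMap.comp_apply,
    LinearMap.mulLeft_apply]
  have hX : ∀ a, plen ((X 0 : MvPolynomial (Fin 3) ℂ) ^ a) ≤ 1 := fun a => by
    simpa using plen_X_pow_mul_le a 0 0
  have hXm : ∀ (a : ℕ) (Q : MvPolynomial (Fin 3) ℂ), plen (X 0 ^ a * Q) ≤ plen Q := fun a Q =>
    (plen_mul_le _ _).trans (mul_le_of_le_one_left (plen_nonneg _) (hX a))
  have hone : ∀ w : Fin 3 →₀ ℕ, plen (monomial w (1 : ℂ)) = 1 := fun w => by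
    rw [plen_monomial, norm_one]
  have hhom : ∀ w : Fin 3 →₀ ℕ, (monomial w (1 : ℂ)).IsHomogeneous w.degree := fun w =>
    isHomogeneous_monomial 1 rfl
  rcases hDn.eq_or_lt with rfl | hlt
  · rw [lengthExponent, if_pos le_rfl, Real.rpow_one]
    refine (IsFormSum.of_mem (sub_interp_mem_jetIdeal hx hT _ _) ?_).mono ?_
    · refine (hv ▸ hhom v).sub ?_
      have := (isHomogeneous_X_pow (R := ℂ) (0 : Fin 3) (D - k)).mul
        (isHomogeneous_interp hx hT (monomial v 1))
      rwa [Nat.sub_add_cancel (by omega)] at this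
    · have h := hB D hnN le_rfl _ (hv ▸ hhom v)
      rw [hone, mul_one] at h
      exact (plen_sub_le _ _).trans (add_le_add (hone v).le ((hXm _ _).trans h))
  · obtain ⟨M, hM⟩ : ∃ M, M = max D ((n + 1) / 2) := ⟨_, rfl⟩
    obtain ⟨m, hm⟩ : ∃ m, m = max D (n - M + k) := ⟨_, rfl⟩
    obtain ⟨u, w, rfl, hw⟩ := exists_add_eq_degree_eq (v := v) (m := M) (by omega)
    rw [map_add] at hv
    have huw : monomial (u + w) (1 : ℂ) = monomial u 1 * monomial w 1 := by
      rw [monomial_mul, one_mul]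
    have hwB := hB M (by omega) (by omega) _ (hw ▸ hhom w)
    rw [hone, mul_one] at hwB
    set H := monomial u (1 : ℂ) * (X 0 ^ (m - (n - M + k)) * interp k x T (monomial w 1)) with hH
    have hHhom : H.IsHomogeneous m := by
      have := (hhom u).mul ((isHomogeneous_X_pow (R := ℂ) (0 : Fin 3) (m - (n - M + k))).mul
        (isHomogeneous_interp hx hT (monomial w 1)))
      rwa [show u.degree + (m - (n - M + k) + k) = m by omega] at this
    have hHlen : plen H ≤ B := (plen_monomial_mul_le _ _).trans ((hXm _ _).trans hwB)
    have hXH : X 0 ^ (n - m) * H =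
        monomial u 1 * (X 0 ^ (M - k) * interp k x T (monomial w 1)) := by
      rw [hH, show M - k = n - m + (m - (n - M + k)) by omega, pow_add]
      ring
    have hHinterp : interp k x T H = interp k x T (monomial (u + w) 1) := by
      rw [← interp_X_zero_pow_mul k x T (n - m), hXH, ← sub_eq_zero, ← map_sub, huw, ← mul_sub,
        ← neg_sub, mul_neg, map_neg, neg_eq_zero]
      exact interp_eq_zero (Ideal.mul_mem_left _ _ (sub_interp_mem_jetIdeal hx hT _ _))
    have h1 := (ih M (by omega) (by omega) (by omega) (hw ▸ hhom w)).mul (hhom u)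
    have h2 := (ih m (by omega) (by omega) (by omega) hHhom).mul
      (isHomogeneous_X_pow (0 : Fin 3) (n - m))
    rw [show u.degree + M = n by omega] at h1
    rw [show n - m + m = n by omega, hHinterp] at h2
    have heq : monomial (u + w) (1 : ℂ) - X 0 ^ (n - k) * interp k x T (monomial (u + w) 1) =
        monomial u 1 * (monomial w 1 - X 0 ^ (M - k) * interp k x T (monomial w 1)) +
        X 0 ^ (n - m) * (H - X 0 ^ (m - k) * interp k x T (monomial (u + w) 1)) := by
      rw [mul_sub, mul_sub, hXH, ← huw, show n - k = n - m + (m - k) by omega, pow_add]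
      ring
    rw [heq]
    refine (h1.add h2).mono ?_
    rw [hone, hone, mul_one, mul_one]
    have hC : 1 ≤ 1 + B := by linarith
    have e1 := one_add_lengthExponent_le (m := M) (by omega) hlt (by omega)
    have e2 := one_add_lengthExponent_le (m := m) (by omega) hlt (by omega)
    have hp : ∀ a : ℝ, 0 ≤ (1 + B) ^ a := fun a => Real.rpow_nonneg (by linarith) a
    have hpow : ∀ a : ℝ, 1 + a ≤ lengthExponent D n →
        (1 + B) ^ a ≤ (1 + B) ^ (lengthExponent D n - 1) := fun a ha =>
      Real.rpow_le_rpow_of_exponent_le hC (by linarith)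
    calc (1 + B) ^ lengthExponent D M +
          (1 + B) ^ lengthExponent D m * plen H * plen ((X 0 : MvPolynomial (Fin 3) ℂ) ^ (n - m))
        ≤ (1 + B) ^ (lengthExponent D n - 1) + (1 + B) ^ (lengthExponent D n - 1) * B * 1 :=
          add_le_add (hpow _ e1) (mul_le_mul
            (mul_le_mul (hpow _ e2) hHlen (plen_nonneg _) (hp _)) (hX _) (plen_nonneg _)
            (mul_nonneg (hp _) hB0))
      _ = (1 + B) ^ (lengthExponent D n - 1) * (1 + B) := by ring
      _ = (1 + B) ^ lengthExponent D n := by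
          rw [← Real.rpow_add_one (by linarith), sub_add_cancel]

lemma two_mul_add_pow_le {k n N : ℕ} (T : ℕ) (hn : n ≤ N) (hN : 3 * (k + 1) ≤ N) :
    (2 * (n + k) : ℝ) ^ T ≤ ((N : ℝ) ^ 2) ^ T := by
  have : 2 * (n + k) ≤ N ^ 2 := by nlinarith
  exact pow_le_pow_left₀ (by positivity) (by exact_mod_cast this) T

/-- The case of the base point `(1, 0, 1)`. -/
lemma isFormSum_of_mem_jetIdeal {D T N : ℕ} (hD : 3 ≤ D) (hT : T ≤ (D / 3 + 1).choose 2)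
    (hN : D ≤ N) {Q : MvPolynomial (Fin 3) ℂ} (hQ : Q ∈ jetIdeal 0 1 T)
    (hQh : Q.IsHomogeneous N) :
    IsFormSum 0 1 T D N ((N : ℝ) ^ (6 * (T : ℝ) * Real.log N) * plen Q) Q := by
  obtain ⟨k, hk⟩ : ∃ k, D / 3 = k + 1 := ⟨D / 3 - 1, by omega⟩
  have hx := isAdmissible_node k
  rw [hk] at hT
  have hN1 : (1 : ℝ) ≤ N := by exact_mod_cast (by omega : 1 ≤ N)
  have hB0 : 0 ≤ ((N : ℝ) ^ 2) ^ T - 1 :=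
    sub_nonneg.mpr (one_le_pow₀ (one_le_pow₀ hN1))
  have h := isFormSum_sub_interp hx hT (D := D) (N := N) (by omega) hB0
    (fun n hn hDn P hP => (plen_interp_le hx hT (by omega) hP).trans
      (mul_le_mul_of_nonneg_right
        (sub_le_sub_right (two_mul_add_pow_le T hn (by omega)) 1) (plen_nonneg _)))
    N hN le_rfl hQh
  rw [interp_eq_zero hQ, mul_zero, sub_zero] at h
  refine h.mono (mul_le_mul_of_nonneg_right ?_ (plen_nonneg _))
  rw [add_sub_cancel, ← pow_mul, ← Real.rpow_natCast, ← Real.rpow_mul (by positivity)]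
  refine Real.rpow_le_rpow_of_exponent_le hN1 ?_
  have := lengthExponent_le (D := D) (n := N) (by omega)
  push_cast
  nlinarith [T.cast_nonneg (α := ℝ)]

end Decomposition

section Translation

lemma map_mem_jetIdeal {ξ η ξ' η' : ℂ} {T : ℕ}
    (f : MvPolynomial (Fin 3) ℂ →ₐ[ℂ] MvPolynomial (Fin 3) ℂ)
    (hder : ∀ i, derDD (f (X i)) = f (derDD (X i)))
    (heval : ∀ i, eval ![1, ξ', η'] (f (X i)) = ![1, ξ, η] i) {P : MvPolynomial (Fin 3) ℂ}
    (hP : P ∈ jetIdeal ξ η T) : f P ∈ jetIdeal ξ' η' T := by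
  have hder' : ∀ P, derDD (f P) = f (derDD P) := by
    intro P
    induction P using MvPolynomial.induction_on with
    | C a => simp [← algebraMap_eq]
    | add p q hp hq => simp only [map_add, hp, hq]
    | mul_X p i hp => simp only [map_mul, Derivation.leibniz, smul_eq_mul, map_add, hp, hder]
  have hiter : ∀ i, derDD^[i] (f P) = f (derDD^[i] P) := by
    intro i
    induction i with
    | zero => rfl
    | succ i ih => rw [Function.iterate_succ_apply', ih, hder', Function.iterate_succ_apply']
  have heval' : ∀ P, eval ![1, ξ', η'] (f P) = eval ![1, ξ, η] P := by
    intro P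
    induction P using MvPolynomial.induction_on with
    | C a => rw [← algebraMap_eq, AlgHom.commutes, algebraMap_eq, eval_C, eval_C]
    | add p q hp hq => simp only [map_add, hp, hq]
    | mul_X p i hp => simp only [map_mul, hp, heval, eval_X]
  rw [mem_jetIdeal] at hP ⊢
  intro i hi
  rw [hiter, heval', hP i hi]

lemma plen_X (i : Fin 3) : plen (X i) = 1 := by
  rw [X, plen_monomial, norm_one]

end Translation

theorem stmt8 (ξ η : ℂ) (hη : η ≠ 0) (D T : ℕ) (hD : 3 ≤ D) (hT1 : 1 ≤ T)
    (hT2 : T ≤ Nat.choose (D / 3 + 1) 2) (N : ℕ) (hN : D ≤ N)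
    (Q : MvPolynomial (Fin 3) ℂ) (hQ : Q ∈ Igam ξ η T) (hQh : Q.IsHomogeneous N) :
    ∃ P : (Fin 3 → ℕ) → MvPolynomial (Fin 3) ℂ,
      (∀ ν ∈ Finset.Nat.antidiagonalTuple 3 (N - D),
        P ν ∈ Igam ξ η T ∧ (P ν).IsHomogeneous D) ∧
      Q = ∑ ν ∈ Finset.Nat.antidiagonalTuple 3 (N - D), (∏ j, X j ^ ν j) * P ν ∧
      ∑ ν ∈ Finset.Nat.antidiagonalTuple 3 (N - D), plen (P ν) ≤
        ((2 + ‖ξ‖ + ‖η‖⁻¹) * max 1 (max ‖ξ‖ ‖η‖)) ^ (2 * N) *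
          (N : ℝ) ^ (6 * (T : ℝ) * Real.log N) * plen Q := by
  set c : ℝ := (2 + ‖ξ‖ + ‖η‖⁻¹) * max 1 (max ‖ξ‖ ‖η‖) with hc
  have hm1 : 1 ≤ max 1 (max ‖ξ‖ ‖η‖) := le_max_left _ _
  have hmξ : ‖ξ‖ ≤ max 1 (max ‖ξ‖ ‖η‖) := (le_max_left _ _).trans (le_max_right _ _)
  have hmη : ‖η‖ ≤ max 1 (max ‖ξ‖ ‖η‖) := (le_max_right _ _).trans (le_max_right _ _)
  have hξ0 := norm_nonneg ξ
  have hη0 : 0 ≤ ‖η‖⁻¹ := inv_nonneg.mpr (norm_nonneg η)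
  have hc1 : 2 + ‖ξ‖ + ‖η‖⁻¹ ≤ c := le_mul_of_one_le_right (by linarith) hm1
  have hc2 : 2 * max 1 (max ‖ξ‖ ‖η‖) ≤ c :=
    mul_le_mul_of_nonneg_right (by linarith) (by linarith)
  set g : Fin 3 → MvPolynomial (Fin 3) ℂ := ![X 0, X 1 - C ξ * X 0, C η⁻¹ * X 2] with hg
  have hX1 : ∀ i, (X i : MvPolynomial (Fin 3) ℂ).IsHomogeneous 1 := isHomogeneous_X ℂ
  have hτ : plen (tauG ξ η Q) ≤ c ^ N * plen Q := by
    refine plen_aeval_le (fun i => ?_) hQh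
    fin_cases i
    · simpa [plen_X] using by linarith
    · refine (plen_add_le _ _).trans ?_
      rw [plen_C_mul, plen_X, plen_X]
      linarith
    · refine (plen_C_mul _ _).le.trans ?_
      rw [plen_X]
      linarith
  have hτhom : (tauG ξ η Q).IsHomogeneous N := by
    rw [← one_mul N]
    refine hQh.aeval _ fun i => ?_
    fin_cases i
    · exact hX1 0
    · exact ((hX1 0).C_mul _).add (hX1 1)
    · exact (hX1 2).C_mul _
  have hτJ : tauG ξ η Q ∈ jetIdeal 0 1 T := by
    refine map_mem_jetIdeal (tauG ξ η) (fun i => ?_) (fun i => ?_) (Igam_le_jetIdeal ξ η T hQ) <;>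
      fin_cases i <;> simp [tauG]
  have hgJ : ∀ P ∈ jetIdeal 0 1 T, aeval g P ∈ jetIdeal ξ η T := fun P hP => by
    refine map_mem_jetIdeal (aeval g) (fun i => ?_) (fun i => ?_) hP <;>
      fin_cases i <;> simp [hg, hη]
  have hgτ : aeval g (tauG ξ η Q) = Q := by
    have : (aeval g).comp (tauG ξ η) = AlgHom.id ℂ _ := by
      refine algHom_ext fun i => ?_
      fin_cases i
      · simp [tauG, hg]
      · simp [tauG, hg, ← algebraMap_eq]
      · have h2 : tauG ξ η (X 2) = C η * X 2 := by simp [tauG]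
        change aeval g (tauG ξ η (X 2)) = X 2
        rw [h2, map_mul, algHom_C, aeval_X, algebraMap_eq]
        change C η * (C η⁻¹ * X 2) = X 2
        rw [← mul_assoc, ← C_mul, mul_inv_cancel₀ hη, C_1, one_mul]
    exact DFunLike.congr_fun this Q
  have h := (isFormSum_of_mem_jetIdeal hD hT2 hN hτJ hτhom).aeval (c := c) (f := g)
    (fun i => by
      fin_cases i
      · simpa [hg, plen_X] using by linarith
      · refine (plen_sub_le _ _).trans ?_
        rw [plen_C_mul, plen_X, plen_X]
        linarith
      · refine (plen_C_mul _ _).le.trans ?_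
        rw [plen_X, norm_inv]
        linarith)
    (fun i => by
      fin_cases i
      · exact hX1 0
      · exact (hX1 1).sub ((hX1 0).C_mul _)
      · exact (hX1 2).C_mul _) hgJ
  rw [hgτ] at h
  obtain ⟨P, hP, hPQ, hPK⟩ := h.exists_eq_sum
  refine ⟨P, fun ν hν => ⟨mem_Igam_of_mem_jetIdeal (hP ν hν).1 (hP ν hν).2, (hP ν hν).2⟩, hPQ,
    hPK.trans ?_⟩
  have hN0 : 0 ≤ (N : ℝ) ^ (6 * (T : ℝ) * Real.log N) := Real.rpow_nonneg N.cast_nonneg _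
  have hcN : 0 ≤ c ^ N := pow_nonneg (by linarith) N
  calc _ ≤ c ^ N * ((N : ℝ) ^ (6 * (T : ℝ) * Real.log N) * (c ^ N * plen Q)) := by gcongr
    _ = _ := by rw [two_mul, pow_add]; ring
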